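/- arXiv:1208.5832 — 2 statements merged into one kernel-verified Lean document; each statement's English description precedes it below -/
import Mathlib

section
/- Let ω_n = [2^{−n}, 2^{−n+1}) for n ≥ 1, and partition each ω_n into 2ⁿ disjoint intervals ω_{n,m} (m = 1,…,2ⁿ) each of length 2^{−2n}. Suppose 1 < p < ∞, p ≠ 2. Then there exists a bounded sequence (c_{n,m}) such that σ(ξ) = Σ_{n≥1} Σ_{m=1}^{2ⁿ} c_{n,m} χ_{ω_{n,m}}(ξ) is not a Fourier multiplier on L^p(ℝ). -/
open MeasureTheory Complex
open scoped ENNReal NNReal Real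

noncomputable section

/-- Short-time Fourier transform on `ℝ`. -/
def STFT1 (g f : ℝ → ℂ) (x ξ : ℝ) : ℂ :=
  ∫ t : ℝ, Complex.exp (Complex.ofReal (-2 * Real.pi * (t * ξ)) * Complex.I) *
    (starRingEnd ℂ) (g (t - x)) * f t

/-- Fourier transform on `ℝ`. -/
def fourier1 (f : ℝ → ℂ) (ξ : ℝ) : ℂ :=
  ∫ t : ℝ, Complex.exp (Complex.ofReal (-2 * Real.pi * (t * ξ)) * Complex.I) * f t

/-- Inverse Fourier transform on `ℝ`. -/
def fourierInv1 (f : ℝ → ℂ) (x : ℝ) : ℂ :=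
  ∫ ξ : ℝ, Complex.exp (Complex.ofReal (2 * Real.pi * (x * ξ)) * Complex.I) * f ξ

/-- Fourier multiplier operator `T_σ f = (σ f̂)^∨` on `ℝ`. -/
def mulOp1 (σ : ℝ → ℂ) (f : ℝ → ℂ) : ℝ → ℂ :=
  fourierInv1 (fun ξ => σ ξ * fourier1 f ξ)

/-- Modulation space norm `‖f‖_{M_{p,q}(ℝ)}` with window `g`. -/
def MNorm1 (p q : ℝ≥0∞) (g f : ℝ → ℂ) : ℝ≥0∞ :=
  eLpNorm (fun ξ : ℝ => (eLpNorm (fun x : ℝ => STFT1 g f x ξ) p volume).toReal) q volume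

/-- `ℓ²(ℤ)`-valued modulation space norm with window `g`. -/
def Ml2Norm1 (p q : ℝ≥0∞) (g : ℝ → ℂ) (F : ℤ → ℝ → ℂ) : ℝ≥0∞ :=
  eLpNorm (fun ξ : ℝ =>
    (eLpNorm (fun x : ℝ => Real.sqrt (∑' m : ℤ, ‖STFT1 g (F m) x ξ‖ ^ 2)) p volume).toReal)
    q volume

/-- The discrete (`ℓ^q(ℤ)` of `L^p`) mixed norm used in the equivalent definition of
modulation space norms. -/
def lqlpNorm (p q : ℝ≥0∞) (F : ℤ → ℝ → ℂ) : ℝ≥0∞ :=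
  eLpNorm (fun k : ℤ => (eLpNorm (F k) p volume).toReal) q Measure.count

/-- The discrete (`ℓ^q(ℤ)` of `L^p`) mixed norm of an `ℓ²(ℤ)`-valued family. -/
def lqlpl2Norm (p q : ℝ≥0∞) (F : ℤ → ℤ → ℝ → ℂ) : ℝ≥0∞ :=
  eLpNorm (fun k : ℤ =>
    (eLpNorm (fun x : ℝ => Real.sqrt (∑' m : ℤ, ‖F k m x‖ ^ 2)) p volume).toReal)
    q Measure.count

/-- The cutoff Fourier multiplier operator `S_ω` associated with the interval
`ω = [a, b)`. -/
def cutoff (a b : ℝ) (f : ℝ → ℂ) : ℝ → ℂ :=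
  mulOp1 (Set.indicator (Set.Ico a b) (fun _ => (1 : ℂ))) f
/-- `σ` is a Fourier multiplier on `L^p(ℝ)`. -/
def IsLpMultiplier1 (p : ℝ≥0∞) (σ : ℝ → ℂ) : Prop :=
  ∃ C : ℝ≥0, ∀ f : SchwartzMap ℝ ℂ,
    eLpNorm (mulOp1 σ ⇑f) p volume ≤ C * eLpNorm (⇑f) p volume

/-- Left endpoint of the subinterval `ω_{n,m}`: the dyadic interval
`ω_n = [2^{-n}, 2^{-n+1})` (here indexed by `n+1`, `n : ℕ`) is partitioned into `2^{n}`
intervals of equal length `2^{-2n}`. -/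
def leftPt (n : ℕ) (m : Fin (2 ^ (n + 1))) : ℝ :=
  (2 : ℝ) ^ (-(n + 1 : ℤ)) + (m : ℕ) * (2 : ℝ) ^ (-(2 * (n + 1) : ℤ))

/-- The subinterval `ω_{n,m} ⊆ [2^{-n}, 2^{-n+1})` of length `2^{-2n}`. -/
def subInterval (n : ℕ) (m : Fin (2 ^ (n + 1))) : Set ℝ :=
  Set.Ico (leftPt n m) (leftPt n m + (2 : ℝ) ^ (-(2 * (n + 1) : ℤ)))

def ez (x : ℝ) : ℂ := Complex.exp (Complex.ofReal (2 * Real.pi * x) * Complex.I)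

lemma norm_ez (x : ℝ) : ‖ez x‖ = 1 := by
  unfold ez; exact Complex.norm_exp_ofReal_mul_I _

lemma ez_add (x y : ℝ) : ez (x + y) = ez x * ez y := by
  unfold ez; rw [← Complex.exp_add]; congr 1; push_cast; ring

lemma ez_nat (m : ℕ) (x : ℝ) : ez (m * x) = ez x ^ m := by
  unfold ez; rw [← Complex.exp_nat_mul]; congr 1; push_cast; ring

lemma continuous_ez : Continuous ez := by unfold ez; fun_prop

def DD (N : ℕ) (e : ℕ → ℝ) (x : ℝ) : ℂ := ∑ m ∈ Finset.range N, (e m : ℂ) * ez x ^ m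

lemma continuous_DD (N : ℕ) (e : ℕ → ℝ) : Continuous (DD N e) := by
  unfold DD; have := continuous_ez; fun_prop

lemma rs (n : ℕ) : ∃ a b : ℕ → ℝ, (∀ m, a m = 1 ∨ a m = -1) ∧ (∀ m, b m = 1 ∨ b m = -1) ∧
    ∀ x, ‖DD (2 ^ n) a x‖ ^ 2 + ‖DD (2 ^ n) b x‖ ^ 2 = 2 * (2 : ℝ) ^ n := by
  induction n with
  | zero =>
    refine ⟨fun _ => 1, fun _ => 1, by simp, by simp, fun x => ?_⟩
    simp [DD]; norm_num
  | succ n ih =>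
    obtain ⟨a, b, ha, hb, h⟩ := ih
    refine ⟨fun m => if m < 2 ^ n then a m else b (m - 2 ^ n),
      fun m => if m < 2 ^ n then a m else - b (m - 2 ^ n), ?_, ?_, fun x => ?_⟩
    · intro m; dsimp only; split_ifs; exacts [ha m, hb _]
    · intro m; dsimp only; split_ifs
      · exact ha m
      · rcases hb (m - 2 ^ n) with h | h <;> simp [h]
    · have e1 : DD (2 ^ (n + 1)) (fun m => if m < 2 ^ n then a m else b (m - 2 ^ n)) x
          = DD (2 ^ n) a x + ez x ^ (2 ^ n) * DD (2 ^ n) b x := by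
        unfold DD
        rw [pow_succ, mul_two, Finset.sum_range_add, Finset.mul_sum]
        congr 1
        · refine Finset.sum_congr rfl fun m hm => ?_
          beta_reduce; rw [if_pos (Finset.mem_range.1 hm)]
        · refine Finset.sum_congr rfl fun m hm => ?_
          beta_reduce; rw [if_neg (by omega), Nat.add_sub_cancel_left, pow_add]; ring
      have e2 : DD (2 ^ (n + 1)) (fun m => if m < 2 ^ n then a m else - b (m - 2 ^ n)) x
          = DD (2 ^ n) a x - ez x ^ (2 ^ n) * DD (2 ^ n) b x := by
        unfold DD
        rw [pow_succ, mul_two, Finset.sum_range_add, Finset.mul_sum, sub_eq_add_neg,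
          ← Finset.sum_neg_distrib]
        congr 1
        · refine Finset.sum_congr rfl fun m hm => ?_
          beta_reduce; rw [if_pos (Finset.mem_range.1 hm)]
        · refine Finset.sum_congr rfl fun m hm => ?_
          beta_reduce; rw [if_neg (by omega), Nat.add_sub_cancel_left, pow_add]; push_cast; ring
      rw [e1, e2]
      have := parallelogram_law_with_norm ℂ (DD (2 ^ n) a x) (ez x ^ (2 ^ n) * DD (2 ^ n) b x)
      have e3 : ‖ez x ^ (2 ^ n) * DD (2 ^ n) b x‖ = ‖DD (2 ^ n) b x‖ := by
        rw [norm_mul, norm_pow, norm_ez]; simp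
      rw [e3] at this
      have h1 := h x
      rw [pow_succ (2 : ℝ) n]
      nlinarith

lemma DD_le (N : ℕ) (x : ℝ) : ‖DD N (fun _ => 1) x‖ ≤ N := by
  unfold DD
  refine (norm_sum_le _ _).trans ?_
  simp [norm_ez]

lemma DD_mul (N : ℕ) (x : ℝ) : ‖DD N (fun _ => 1) x‖ * ‖ez x - 1‖ ≤ 2 := by
  rw [← norm_mul]
  unfold DD
  simp only [Complex.ofReal_one, one_mul]
  rw [geom_sum_mul]
  refine (norm_sub_le _ _).trans ?_
  rw [norm_pow, norm_ez]; norm_num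

lemma ez_sub_one_le (x : ℝ) : ‖ez x - 1‖ ≤ 2 * π * |x| := by
  have := Real.norm_exp_I_mul_ofReal_sub_one_le (x := 2 * π * x)
  unfold ez
  rw [mul_comm _ I]
  refine this.trans ?_
  rw [Real.norm_eq_abs, abs_mul, abs_of_pos (by positivity)]

lemma DD_ge (N : ℕ) (x : ℝ) (hx : |x| * (16 * N) ≤ 1) : (N : ℝ) / 2 ≤ ‖DD N (fun _ => 1) x‖ := by
  have h1 : ‖DD N (fun _ => 1) x - N‖ ≤ N * (1 / 2) := by
    have : DD N (fun _ => 1) x - N = ∑ m ∈ Finset.range N, (ez (m * x) - 1) := by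
      simp [DD, ez_nat]
    rw [this]
    refine (norm_sum_le_of_le (f := fun m : ℕ => ez (m * x) - 1) (n := fun _ => 1/2) (Finset.range N) ?_).trans (by simp)
    intro m hm
    have hm' : (m : ℝ) ≤ N := by exact_mod_cast (Finset.mem_range.1 hm).le
    refine (ez_sub_one_le _).trans ?_
    rw [abs_mul, Nat.abs_cast]
    have := Real.pi_lt_four
    have h3 : (m : ℝ) * |x| ≤ 1 / 16 := by nlinarith [abs_nonneg x]
    have h4 : 0 ≤ (m : ℝ) * |x| := by positivity
    nlinarith
  have h2 : ‖(N : ℂ)‖ - ‖DD N (fun _ => 1) x - N‖ ≤ ‖DD N (fun _ => 1) x‖ := by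
    have := norm_sub_norm_le (N : ℂ) ((N : ℂ) - DD N (fun _ => 1) x)
    rw [sub_sub_cancel] at this
    rwa [norm_sub_rev _ (N : ℂ)]
  rw [Complex.norm_natCast] at h2
  linarith

lemma ez_sub_one_ge (x : ℝ) (h0 : 0 ≤ x) (h1 : x ≤ 1) : min x (1 - x) ≤ ‖ez x - 1‖ := by
  have e : ‖ez x - 1‖ = 2 * |Real.sin (π * x)| := by
    unfold ez
    rw [mul_comm _ I, Complex.norm_exp_I_mul_ofReal_sub_one]
    rw [norm_mul, Real.norm_eq_abs, Real.norm_eq_abs]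
    norm_num
    congr 2; ring
  rw [e]
  have hp := Real.pi_pos
  have key : ∀ y : ℝ, 0 ≤ y → y ≤ 1/2 → y ≤ 2 * |Real.sin (π * y)| := by
    intro y hy hy2
    have := Real.mul_le_sin (x := π * y) (by positivity) (by nlinarith)
    have h : 2 / π * (π * y) = 2 * y := by field_simp
    rw [h] at this
    have := le_abs_self (Real.sin (π * y))
    linarith
  rcases le_total x (1/2) with h | h
  · exact (min_le_left _ _).trans (key x h0 h)
  · refine (min_le_right _ _).trans ((key (1 - x) (by linarith) (by linarith)).trans ?_)
    rw [mul_sub, mul_one, Real.sin_pi_sub]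

def II (p : ℝ) (φ : SchwartzMap ℝ ℂ) (N : ℕ) (e : ℕ → ℝ) : ℝ≥0∞ :=
  ∫⁻ x, ENNReal.ofReal (‖φ x * DD N e x‖ ^ p)

lemma growth {α β : ℝ} (h : α < β) (A : ℝ) {B : ℝ} (hB : 0 < B) :
    ∀ᶠ n : ℕ in Filter.atTop, A * ((2 : ℝ) ^ (n + 1)) ^ α < B * ((2 : ℝ) ^ (n + 1)) ^ β := by
  have h1 : Filter.Tendsto (fun n : ℕ => (2 : ℝ) ^ (n + 1)) Filter.atTop Filter.atTop :=
    (Filter.tendsto_add_atTop_iff_nat 1).2 (tendsto_pow_atTop_atTop_of_one_lt one_lt_two)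
  have h2 := (tendsto_rpow_atTop (sub_pos.2 h)).comp h1
  filter_upwards [h2.eventually_gt_atTop (A / B)] with n hn
  simp only [Function.comp] at hn
  rw [div_lt_iff₀ hB] at hn
  have e : ((2 : ℝ) ^ (n + 1)) ^ β = ((2 : ℝ) ^ (n + 1)) ^ (β - α) * ((2 : ℝ) ^ (n + 1)) ^ α := by
    rw [← Real.rpow_add (by positivity)]; congr 1; ring
  have hpos : 0 < ((2 : ℝ) ^ (n + 1)) ^ α := by positivity
  rw [e]; nlinarith

lemma decay2 (φ : SchwartzMap ℝ ℂ) : ∃ B : ℝ, 0 < B ∧ ∀ x, ‖φ x‖ ≤ B / (1 + x ^ 2) := by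
  obtain ⟨C0, h0, hC0⟩ := φ.decay 0 0
  obtain ⟨C2, h2, hC2⟩ := φ.decay 2 0
  refine ⟨C0 + C2, by positivity, fun x => ?_⟩
  have a0 := hC0 x
  have a2 := hC2 x
  simp at a0 a2
  rw [le_div_iff₀ (by positivity)]
  nlinarith

lemma decayp (φ : SchwartzMap ℝ ℂ) {p : ℝ} (hp : 1 ≤ p) :
    ∃ B : ℝ, 0 < B ∧ ∀ x, ‖φ x‖ ^ p ≤ B / (1 + x ^ 2) := by
  obtain ⟨B, hB, h⟩ := decay2 φ
  refine ⟨B ^ p, by positivity, fun x => ?_⟩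
  refine (Real.rpow_le_rpow (norm_nonneg _) (h x) (by linarith)).trans ?_
  rw [Real.div_rpow hB.le (by positivity)]
  gcongr
  have : (1:ℝ) ≤ 1 + x ^ 2 := by nlinarith
  simpa using Real.rpow_le_rpow_of_exponent_le this hp

lemma Iphi_lt_top (φ : SchwartzMap ℝ ℂ) {p : ℝ} (hp : 1 ≤ p) :
    ∫⁻ x, ENNReal.ofReal (‖φ x‖ ^ p) < ⊤ := by
  obtain ⟨B, hB, h⟩ := decayp φ hp
  have hi : Integrable (fun x : ℝ => B * (1 + x ^ 2)⁻¹) := integrable_inv_one_add_sq.const_mul B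
  refine lt_of_le_of_lt (lintegral_mono fun x => ?_) hi.lintegral_lt_top
  exact ENNReal.ofReal_le_ofReal (h x)

lemma Iphi_pos (φ : SchwartzMap ℝ ℂ) (h0 : φ 0 ≠ 0) {p : ℝ} (hp : 1 ≤ p) :
    0 < ∫⁻ x, ENNReal.ofReal (‖φ x‖ ^ p) := by
  have hc : Continuous fun x => ENNReal.ofReal (‖φ x‖ ^ p) := by
    refine ENNReal.continuous_ofReal.comp ?_
    exact (φ.continuous.norm).rpow_const fun x => Or.inr (by linarith)
  rw [lintegral_pos_iff_support hc.measurable]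
  have ho : IsOpen (Function.support fun x => ENNReal.ofReal (‖φ x‖ ^ p)) := by
    exact isOpen_ne_fun hc continuous_const
  refine ho.measure_pos _ ⟨0, ?_⟩
  have : 0 < ‖φ 0‖ := norm_pos_iff.2 h0
  simp only [Function.mem_support, ne_eq, ENNReal.ofReal_eq_zero, not_le]
  positivity

lemma core_gt {p : ℝ} (hp : 2 < p) (φ : SchwartzMap ℝ ℂ) (h0 : φ 0 ≠ 0) (C : ℝ≥0) :
    ∃ n : ℕ, ∀ a : ℕ → ℝ, (∀ x, ‖DD (2 ^ (n + 1)) a x‖ ^ 2 ≤ 2 * (2 : ℝ) ^ (n + 1)) →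
      C * II p φ (2 ^ (n + 1)) a < II p φ (2 ^ (n + 1)) (fun _ => 1) := by
  set Φ := ∫⁻ x, ENNReal.ofReal (‖φ x‖ ^ p) with hΦ
  have hΦt : Φ ≠ ⊤ := (Iphi_lt_top φ (by linarith)).ne
  set δ := ‖φ 0‖ / 2 with hδ
  have hn0 : 0 < ‖φ 0‖ := norm_pos_iff.2 h0
  have hδ0 : 0 < δ := by positivity
  have hev : ∀ᶠ x in nhds (0 : ℝ), δ < ‖φ x‖ :=
    (φ.continuous.norm.tendsto 0).eventually_const_lt (by rw [hδ]; linarith)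
  obtain ⟨r, hr, hball⟩ := Metric.eventually_nhds_iff.1 hev
  have g1 := growth (α := p / 2) (β := p - 1) (by linarith) (C * ((2:ℝ) ^ (p/2) * Φ.toReal))
    (B := (δ / 2) ^ p * (1/16)) (by positivity)
  have g2 := growth (α := 0) (β := 1) (by norm_num) 1 (B := 16 * r) (by positivity)
  obtain ⟨n, hn1, hn2⟩ := (g1.and g2).exists
  refine ⟨n, fun a ha => ?_⟩
  set N : ℝ := (2:ℝ) ^ (n + 1) with hN
  have hNpos : 0 < N := by positivity
  have up : II p φ (2 ^ (n + 1)) a ≤ ENNReal.ofReal ((2 * N) ^ (p/2)) * Φ := by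
    unfold II
    rw [hΦ, ← lintegral_const_mul' _ _ ENNReal.ofReal_ne_top]
    refine lintegral_mono fun x => ?_
    rw [← ENNReal.ofReal_mul (by positivity)]
    refine ENNReal.ofReal_le_ofReal ?_
    rw [norm_mul, Real.mul_rpow (norm_nonneg _) (norm_nonneg _), mul_comm]
    refine mul_le_mul_of_nonneg_right ?_ (by positivity)
    calc ‖DD (2 ^ (n + 1)) a x‖ ^ p = (‖DD (2 ^ (n + 1)) a x‖ ^ 2) ^ (p / 2) := by
          rw [← Real.rpow_natCast, ← Real.rpow_mul (norm_nonneg _)]; congr 1; push_cast; ring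
      _ ≤ _ := Real.rpow_le_rpow (by positivity) (ha x) (by linarith)
  have lo : ENNReal.ofReal ((δ / 2) ^ p * (1/16) * N ^ (p - 1)) ≤
      II p φ (2 ^ (n + 1)) (fun _ => 1) := by
    have hset : ∀ x ∈ Set.Ioc (0:ℝ) (1 / (16 * N)),
        ENNReal.ofReal ((δ / 2) ^ p * N ^ p) ≤
          ENNReal.ofReal (‖φ x * DD (2 ^ (n + 1)) (fun _ => 1) x‖ ^ p) := by
      intro x hx
      refine ENNReal.ofReal_le_ofReal ?_
      rw [← Real.mul_rpow (by positivity) hNpos.le]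
      refine Real.rpow_le_rpow (by positivity) ?_ (by linarith)
      have hx2 : x * (16 * N) ≤ 1 := by
        have := hx.2; rwa [le_div_iff₀ (by positivity)] at this
      have k1 := DD_ge (2 ^ (n + 1)) x (by
        rw [abs_of_pos hx.1]; push_cast; exact hx2)
      push_cast at k1
      rw [← hN] at k1
      have k2 : δ < ‖φ x‖ := by
        apply hball
        rw [Real.dist_eq, sub_zero, abs_of_pos hx.1]
        simp only [Real.rpow_zero, Real.rpow_one, mul_one] at hn2
        by_contra hh
        push Not at hh
        nlinarith
      rw [norm_mul]
      calc δ / 2 * N = δ * (N / 2) := by ring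
        _ ≤ _ := mul_le_mul k2.le k1 (by positivity) (by positivity)
    calc ENNReal.ofReal ((δ / 2) ^ p * (1/16) * N ^ (p - 1))
        = ENNReal.ofReal ((δ / 2) ^ p * N ^ p) * volume (Set.Ioc (0:ℝ) (1 / (16 * N))) := by
          rw [Real.volume_Ioc, ← ENNReal.ofReal_mul (by positivity)]
          congr 1
          rw [Real.rpow_sub_one hNpos.ne']
          field_simp
          ring
      _ = ∫⁻ x in Set.Ioc (0:ℝ) (1 / (16 * N)), ENNReal.ofReal ((δ / 2) ^ p * N ^ p) := by
          rw [setLIntegral_const]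
      _ ≤ ∫⁻ x in Set.Ioc (0:ℝ) (1 / (16 * N)),
            ENNReal.ofReal (‖φ x * DD (2 ^ (n + 1)) (fun _ => 1) x‖ ^ p) :=
          setLIntegral_mono' measurableSet_Ioc hset
      _ ≤ _ := setLIntegral_le_lintegral _ _
  refine lt_of_lt_of_le ?_ lo
  refine lt_of_le_of_lt (mul_le_mul_right up _) ?_
  rw [← ENNReal.ofReal_toReal hΦt, ← ENNReal.ofReal_coe_nnreal, ← ENNReal.ofReal_mul (by positivity),
    ← ENNReal.ofReal_mul (by positivity)]
  refine (ENNReal.ofReal_lt_ofReal_iff (by positivity)).2 ?_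
  rw [Real.mul_rpow (by norm_num) hNpos.le]
  refine lt_of_eq_of_lt ?_ hn1
  ring

lemma ez_sub_int (x : ℝ) (k : ℤ) : ez (x - k) = ez x := by
  unfold ez
  rw [Complex.exp_eq_exp_iff_exists_int]
  exact ⟨-k, by push_cast; ring⟩

def WW (s : ℝ) : ℝ → ℝ≥0∞ :=
  Set.indicator (Set.Ioo 0 1) fun y => ENNReal.ofReal (y ^ (-s) + (1 - y) ^ (-s))

lemma WW_lt_top {s : ℝ} (hs : s < 1) : ∫⁻ y, WW s y < ⊤ := by
  unfold WW
  rw [lintegral_indicator measurableSet_Ioo]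
  have h1 : IntervalIntegrable (fun y : ℝ => y ^ (-s)) volume 0 1 :=
    intervalIntegral.intervalIntegrable_rpow' (by linarith)
  have h2 : IntervalIntegrable (fun y : ℝ => (1 - y) ^ (-s)) volume 0 1 := by
    have := (h1.comp_sub_left 1).symm
    simpa using this
  have h3 := (h1.add h2)
  rw [intervalIntegrable_iff_integrableOn_Ioo_of_le zero_le_one] at h3
  exact h3.lintegral_lt_top

lemma II_one_le {p s : ℝ} (hp : 1 < p) (hs0 : 0 < s) (hs1 : s < 1) (φ : SchwartzMap ℝ ℂ) :
    ∃ J : ℝ≥0∞, J ≠ ⊤ ∧ ∀ N : ℕ,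
      II p φ N (fun _ => 1) ≤ ENNReal.ofReal ((N:ℝ) ^ (p - s)) * J := by
  obtain ⟨B, hB, hdec⟩ := decayp φ hp.le
  set w := ∫⁻ y, WW s y with hw
  have hwt : w ≠ ⊤ := (WW_lt_top hs1).ne
  set S := ∑' k : ℤ, ENNReal.ofReal (6 * B / (1 + (k:ℝ) ^ 2)) with hS
  have hSt : S ≠ ⊤ := by
    have : Summable fun k : ℤ => 6 * B / (1 + (k:ℝ) ^ 2) := by
      have h1 : Summable fun k : ℤ => 6 * B * (1 / (k:ℝ) ^ 2) :=
        (Real.summable_one_div_int_pow.2 (by norm_num)).mul_left _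
      refine h1.of_norm_bounded_eventually ?_
      have : ∀ᶠ k : ℤ in Filter.cofinite, k ≠ 0 := Filter.eventually_cofinite_ne 0
      filter_upwards [this] with k hk
      have hk' : (0:ℝ) < (k:ℝ) ^ 2 := by positivity
      rw [Real.norm_of_nonneg (by positivity), mul_one_div]
      gcongr
      linarith
    exact this.tsum_ofReal_ne_top
  refine ⟨S * w, ENNReal.mul_ne_top hSt hwt, fun N => ?_⟩
  unfold II
  rw [← setLIntegral_univ, ← iUnion_Ico_intCast ℝ]
  refine (lintegral_iUnion_le _ _).trans ?_
  rw [hS, ← ENNReal.tsum_mul_right, ← ENNReal.tsum_mul_left]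
  refine ENNReal.tsum_le_tsum fun k => ?_
  rw [setLIntegral_congr (Ioo_ae_eq_Ico (a := (k:ℝ)) (b := (k:ℝ) + 1)).symm]
  have pt : ∀ x ∈ Set.Ioo (k:ℝ) (k + 1), ENNReal.ofReal (‖φ x * DD N (fun _ => 1) x‖ ^ p) ≤
      ENNReal.ofReal ((N:ℝ) ^ (p - s)) * ENNReal.ofReal (6 * B / (1 + (k:ℝ) ^ 2)) * WW s (x - k) := by
    intro x hx
    have hy0 : 0 < x - k := by linarith [hx.1]
    have hy1 : x - k < 1 := by linarith [hx.2]
    set y := x - k with hy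
    rw [WW, Set.indicator_of_mem (show y ∈ Set.Ioo (0:ℝ) 1 from ⟨hy0, hy1⟩)]
    rw [← ENNReal.ofReal_mul (by positivity), ← ENNReal.ofReal_mul (by positivity)]
    refine ENNReal.ofReal_le_ofReal ?_
    rw [norm_mul, Real.mul_rpow (norm_nonneg _) (norm_nonneg _)]
    have d1 := DD_le N x
    have d2 := DD_mul N x
    have d3 := ez_sub_one_ge y hy0.le hy1.le
    rw [hy, ez_sub_int, ← hy] at d3
    set d := ‖DD N (fun _ => 1) x‖ with hd
    have hd0 : 0 ≤ d := norm_nonneg _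
    set μ := min y (1 - y) with hμ
    have hμ0 : 0 < μ := lt_min hy0 (by linarith)
    have d4 : d ≤ 2 / μ := by
      rw [le_div_iff₀ hμ0]
      exact (mul_le_mul_of_nonneg_left d3 hd0).trans d2
    have a1 : (0:ℝ) ≤ y ^ (-s) := by positivity
    have a2 : (0:ℝ) ≤ (1 - y) ^ (-s) := Real.rpow_nonneg (by linarith) _
    have d5 : d ^ s ≤ 2 * (y ^ (-s) + (1 - y) ^ (-s)) := by
      refine (Real.rpow_le_rpow hd0 d4 hs0.le).trans ?_
      rw [Real.div_rpow (by norm_num) hμ0.le, div_eq_mul_inv, ← Real.rpow_neg hμ0.le]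
      have t1 : (2:ℝ) ^ s ≤ 2 := by
        simpa using Real.rpow_le_rpow_of_exponent_le (one_le_two (α := ℝ)) hs1.le
      refine mul_le_mul t1 ?_ (by positivity) (by norm_num)
      rcases min_choice y (1 - y) with h | h <;> rw [hμ, h] <;> linarith
    have d6 : d ^ p ≤ (N:ℝ) ^ (p - s) * (2 * (y ^ (-s) + (1 - y) ^ (-s))) := by
      have : d ^ p = d ^ (p - s) * d ^ s := by
        rw [← Real.rpow_add' hd0 (by linarith)]; congr 1; ring
      rw [this]
      exact mul_le_mul (Real.rpow_le_rpow hd0 d1 (by linarith)) d5 (by positivity) (by positivity)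
    have d7 : ‖φ x‖ ^ p ≤ 3 * B / (1 + (k:ℝ) ^ 2) := by
      refine (hdec x).trans ?_
      rw [div_le_div_iff₀ (by positivity) (by positivity)]
      have : 1 + (k:ℝ) ^ 2 ≤ 3 * (1 + x ^ 2) := by
        have : (k:ℝ) = x - y := by rw [hy]; ring
        rw [this]; nlinarith [sq_nonneg (x + y)]
      nlinarith
    refine (mul_le_mul d7 d6 (by positivity) (by positivity)).trans (le_of_eq ?_)
    ring
  refine (setLIntegral_mono' measurableSet_Ioo pt).trans ?_
  refine (setLIntegral_le_lintegral _ _).trans ?_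
  rw [lintegral_const_mul' _ _ (ENNReal.mul_ne_top ENNReal.ofReal_ne_top ENNReal.ofReal_ne_top),
    lintegral_sub_right_eq_self (WW s) (k:ℝ), mul_assoc]

lemma core_lt {p : ℝ} (hp1 : 1 < p) (hp : p < 2) (φ : SchwartzMap ℝ ℂ) (h0 : φ 0 ≠ 0) (C : ℝ≥0) :
    ∃ n : ℕ, ∀ a b : ℕ → ℝ,
      (∀ x, ‖DD (2 ^ (n + 1)) a x‖ ^ 2 + ‖DD (2 ^ (n + 1)) b x‖ ^ 2 = 2 * (2 : ℝ) ^ (n + 1)) →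
      C * II p φ (2 ^ (n + 1)) (fun _ => 1) <
        max (II p φ (2 ^ (n + 1)) a) (II p φ (2 ^ (n + 1)) b) := by
  set Φ := ∫⁻ x, ENNReal.ofReal (‖φ x‖ ^ p) with hΦ
  have hΦt : Φ ≠ ⊤ := (Iphi_lt_top φ (by linarith)).ne
  have hΦ0 : 0 < Φ := Iphi_pos φ h0 hp1.le
  have hΦr : 0 < Φ.toReal := ENNReal.toReal_pos hΦ0.ne' hΦt
  obtain ⟨s, hs1, hs2⟩ := exists_between (show p / 2 < 1 by linarith)
  obtain ⟨J, hJ, hJN⟩ := II_one_le hp1 (by linarith) hs2 φ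
  obtain ⟨n, hn⟩ := (growth (α := p - s) (β := p / 2) (by linarith) (2 * C * J.toReal) hΦr).exists
  refine ⟨n, fun a b hab => ?_⟩
  set N : ℝ := (2:ℝ) ^ (n + 1) with hN
  have hNpos : 0 < N := by positivity
  have lo : ENNReal.ofReal (N ^ (p/2)) * Φ ≤ II p φ (2 ^ (n + 1)) a + II p φ (2 ^ (n + 1)) b := by
    unfold II
    have hm : Measurable fun x => ENNReal.ofReal (‖φ x * DD (2 ^ (n + 1)) a x‖ ^ p) := by
      have h1 := φ.continuous.measurable
      have h2 := (continuous_DD (2 ^ (n + 1)) a).measurable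
      fun_prop
    rw [← lintegral_add_left hm, hΦ, ← lintegral_const_mul' _ _ ENNReal.ofReal_ne_top]
    refine lintegral_mono fun x => ?_
    rw [← ENNReal.ofReal_mul (by positivity), ← ENNReal.ofReal_add (by positivity) (by positivity)]
    refine ENNReal.ofReal_le_ofReal ?_
    rw [norm_mul, norm_mul, Real.mul_rpow (norm_nonneg _) (norm_nonneg _),
      Real.mul_rpow (norm_nonneg _) (norm_nonneg _), ← mul_add, mul_comm]
    refine mul_le_mul_of_nonneg_left ?_ (by positivity)
    have key : ∀ u : ℝ, 0 ≤ u → N ≤ u ^ 2 → N ^ (p/2) ≤ u ^ p := by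
      intro u hu h
      calc N ^ (p/2) ≤ (u ^ 2) ^ (p / 2) := Real.rpow_le_rpow hNpos.le h (by linarith)
        _ = u ^ p := by
          rw [← Real.rpow_natCast, ← Real.rpow_mul hu]; congr 1; push_cast; ring
    have hx := hab x
    have q1 : 0 ≤ ‖DD (2 ^ (n + 1)) a x‖ ^ p := by positivity
    have q2 : 0 ≤ ‖DD (2 ^ (n + 1)) b x‖ ^ p := by positivity
    rcases le_total N (‖DD (2 ^ (n + 1)) a x‖ ^ 2) with h | h
    · have := key _ (norm_nonneg _) h
      linarith
    · have := key _ (norm_nonneg (DD (2 ^ (n + 1)) b x)) (by linarith)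
      linarith
  have up := hJN (2 ^ (n + 1))
  push_cast at up
  rw [← hN] at up
  have main : 2 * (C * II p φ (2 ^ (n + 1)) (fun _ => 1)) < ENNReal.ofReal (N ^ (p/2)) * Φ := by
    refine lt_of_le_of_lt (mul_le_mul_right (mul_le_mul_right up _) _) ?_
    rw [← ENNReal.ofReal_toReal hΦt, ← ENNReal.ofReal_toReal hJ, ← ENNReal.ofReal_coe_nnreal,
      ← ENNReal.ofReal_mul (by positivity), ← ENNReal.ofReal_mul (by positivity),
      ← ENNReal.ofReal_mul (by positivity),
      show (2:ℝ≥0∞) = ENNReal.ofReal 2 by simp, ← ENNReal.ofReal_mul (by positivity)]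
    refine (ENNReal.ofReal_lt_ofReal_iff (by positivity)).2 ?_
    rw [mul_comm (N ^ (p/2))]
    refine lt_of_eq_of_lt ?_ hn
    ring
  by_contra hcon
  push Not at hcon
  have h1 := (le_max_left _ _).trans hcon
  have h2 := (le_max_right _ _).trans hcon
  have := lo.trans (add_le_add h1 h2)
  rw [← two_mul] at this
  exact absurd main (not_lt.2 this)

def bmp : ContDiffBump (1/2 : ℝ) := ⟨1/8, 1/4, by norm_num, by norm_num⟩

def Psi (x : ℝ) : ℂ := (bmp x : ℂ)

lemma Psi_zero {x : ℝ} (h : x ∉ Set.Ico (0:ℝ) 1) : Psi x = 0 := by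
  unfold Psi
  rw [bmp.zero_of_le_dist, Complex.ofReal_zero]
  rw [Real.dist_eq]
  show (1/4:ℝ) ≤ _
  by_contra hh
  push Not at hh
  rw [abs_lt] at hh
  exact h ⟨by linarith, by linarith⟩

lemma Psi_smooth : ContDiff ℝ (⊤ : ℕ∞) Psi :=
  Complex.ofRealCLM.contDiff.comp bmp.contDiff

lemma Psi_cs : HasCompactSupport Psi := by
  refine HasCompactSupport.intro (isCompact_Icc (a := (0:ℝ)) (b := 1)) fun x hx => Psi_zero ?_
  exact fun h => hx (Set.Ico_subset_Icc_self h)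

def PsiS : SchwartzMap ℝ ℂ := Psi_cs.toSchwartzMap Psi_smooth

def phi : SchwartzMap ℝ ℂ := FourierTransformInv.fourierInv PsiS

lemma fourier1_eq (f : SchwartzMap ℝ ℂ) :
    fourier1 f = ⇑(FourierTransform.fourier f : SchwartzMap ℝ ℂ) := by
  rw [SchwartzMap.fourier_coe]
  ext ξ
  rw [Real.fourier_eq', fourier1]
  refine integral_congr_ae (Filter.Eventually.of_forall fun t => ?_)
  simp [mul_comm]

lemma fourierInv1_eq (f : SchwartzMap ℝ ℂ) :
    fourierInv1 f = ⇑(FourierTransformInv.fourierInv f : SchwartzMap ℝ ℂ) := by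
  rw [SchwartzMap.fourierInv_coe]
  ext ξ
  rw [Real.fourierInv_eq', fourierInv1]
  refine integral_congr_ae (Filter.Eventually.of_forall fun t => ?_)
  simp [mul_comm]

lemma phi_eq (x : ℝ) : phi x = fourierInv1 Psi x := by
  have := fourierInv1_eq PsiS
  exact (congrFun this x).symm

lemma phi_zero : phi 0 ≠ 0 := by
  rw [phi_eq, fourierInv1]
  simp only [zero_mul, mul_zero, Complex.ofReal_zero, Complex.exp_zero, one_mul, Psi]
  rw [integral_complex_ofReal]
  exact_mod_cast bmp.integral_pos.ne'

def LL (n : ℕ) : ℝ := (2 : ℝ) ^ (-(2 * (n + 1) : ℤ))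

lemma LL_pos (n : ℕ) : 0 < LL n := by unfold LL; positivity

def bb (n m : ℕ) : ℝ := (2 : ℝ) ^ (-(n + 1 : ℤ)) + m * LL n

lemma single_exists (n m : ℕ) : ∃ h : SchwartzMap ℝ ℂ, ∀ ξ, h ξ = Psi ((ξ - bb n m) / LL n) := by
  have hL := LL_pos n
  have cs : HasCompactSupport fun ξ : ℝ => Psi ((ξ - bb n m) / LL n) := by
    refine HasCompactSupport.intro (isCompact_Icc (a := bb n m) (b := bb n m + LL n))
      fun x hx => Psi_zero ?_
    rintro ⟨h1, h2⟩
    apply hx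
    rw [div_lt_iff₀ hL] at h2
    have h3 : 0 ≤ x - bb n m := by
      by_contra hh
      push Not at hh
      exact absurd h1 (not_le.2 (div_neg_of_neg_of_pos hh hL))
    exact ⟨by linarith, by linarith⟩
  have sm : ContDiff ℝ (⊤ : ℕ∞) fun ξ : ℝ => Psi ((ξ - bb n m) / LL n) :=
    Psi_smooth.comp (by fun_prop)
  exact ⟨cs.toSchwartzMap sm, fun ξ => rfl⟩

lemma H_exists (n : ℕ) (e : ℕ → ℝ) : ∃ H : SchwartzMap ℝ ℂ, ∀ ξ,
    H ξ = ∑ m ∈ Finset.range (2 ^ (n + 1)), (e m : ℂ) * Psi ((ξ - bb n m) / LL n) := by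
  choose h hh using single_exists n
  refine ⟨∑ m ∈ Finset.range (2 ^ (n + 1)), (e m : ℂ) • h m, fun ξ => ?_⟩
  rw [sum_apply]
  refine Finset.sum_congr rfl fun m _ => ?_
  rw [smul_apply, hh, smul_eq_mul]

lemma inv_H (n : ℕ) (e : ℕ → ℝ) (x : ℝ) :
    fourierInv1 (fun ξ => ∑ m ∈ Finset.range (2 ^ (n + 1)),
      (e m : ℂ) * Psi ((ξ - bb n m) / LL n)) x
    = LL n * ez ((2 : ℝ) ^ (-(n + 1 : ℤ)) * x) *
      (phi (LL n * x) * DD (2 ^ (n + 1)) e (LL n * x)) := by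
  have hL := LL_pos n
  have one : ∀ m : ℕ, ∫ ξ : ℝ, ez (x * ξ) * Psi ((ξ - bb n m) / LL n) =
      LL n * (ez (x * bb n m) * phi (LL n * x)) := by
    intro m
    have := integral_sub_right_eq_self (μ := volume)
      (fun ξ : ℝ => ez (x * (ξ + bb n m)) * Psi (ξ / LL n)) (bb n m)
    simp only [sub_add_cancel] at this
    rw [this]
    have h2 := Measure.integral_comp_div
      (fun η : ℝ => ez (x * (LL n * η + bb n m)) * Psi η) (LL n)
    have e1 : ∀ ξ : ℝ, LL n * (ξ / LL n) = ξ := fun ξ => by field_simp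
    simp only [e1] at h2
    rw [h2, abs_of_pos hL, phi_eq, fourierInv1, ← integral_const_mul]
    rw [← Complex.coe_smul, smul_eq_mul]
    congr 1
    refine integral_congr_ae (Filter.Eventually.of_forall fun η => ?_)
    show ez _ * _ = _ * (ez _ * _)
    rw [← mul_assoc, ← ez_add]
    congr 2
    ring
  choose h hh using single_exists n
  have int : ∀ m, Integrable fun ξ : ℝ => ez (x * ξ) * ((e m : ℂ) * Psi ((ξ - bb n m) / LL n)) := by
    intro m
    have hi : Integrable fun ξ : ℝ => ((e m : ℂ) * Psi ((ξ - bb n m) / LL n)) := by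
      have := (h m).integrable (μ := volume)
      rw [funext (hh m) (f := ⇑(h m))] at this
      exact this.const_mul _
    refine hi.bdd_mul (c := 1) ?_ (Filter.Eventually.of_forall fun ξ => (norm_ez _).le)
    have := continuous_ez
    exact (by fun_prop : Continuous fun ξ : ℝ => ez (x * ξ)).aestronglyMeasurable
  show ∫ ξ : ℝ, ez (x * ξ) * _ = _
  simp only [Finset.mul_sum]
  rw [integral_finsetSum _ fun m _ => int m]
  unfold DD
  simp only [Finset.mul_sum]
  refine Finset.sum_congr rfl fun m _ => ?_
  have : ∀ ξ : ℝ, ez (x * ξ) * ((e m : ℂ) * Psi ((ξ - bb n m) / LL n)) =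
      (e m : ℂ) * (ez (x * ξ) * Psi ((ξ - bb n m) / LL n)) := fun ξ => by ring
  simp only [this]
  rw [integral_const_mul, one, ← ez_nat]
  have : x * bb n m = (2 : ℝ) ^ (-(n + 1 : ℤ)) * x + m * (LL n * x) := by unfold bb; ring
  rw [this, ez_add]
  ring

lemma LL_eq (n : ℕ) : LL n = (2 : ℝ) ^ (-(n + 1 : ℤ)) * (2 : ℝ) ^ (-(n + 1 : ℤ)) := by
  unfold LL; rw [← zpow_add₀ two_ne_zero]; congr 1; ring

lemma mem_sub {n : ℕ} {m : Fin (2 ^ (n + 1))} {ξ : ℝ} :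
    ξ ∈ subInterval n m ↔ bb n m ≤ ξ ∧ ξ < bb n m + LL n := Iff.rfl

lemma sub_dyadic {n : ℕ} {m : Fin (2 ^ (n + 1))} {ξ : ℝ} (h : ξ ∈ subInterval n m) :
    (2 : ℝ) ^ (-(n + 1 : ℤ)) ≤ ξ ∧ ξ < (2 : ℝ) ^ (-(n : ℤ)) := by
  rw [mem_sub] at h
  have hL := LL_pos n
  unfold bb at h
  constructor
  · have : 0 ≤ ((m : ℕ) : ℝ) * LL n := by positivity
    linarith
  · have hm : (((m : ℕ) : ℝ) + 1) ≤ (2:ℝ) ^ (n + 1) := by exact_mod_cast m.2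
    have h1 : (2:ℝ) ^ (n + 1) * LL n = (2 : ℝ) ^ (-(n + 1 : ℤ)) := by
      rw [LL_eq, ← mul_assoc, ← zpow_natCast, ← zpow_add₀ two_ne_zero]
      push_cast; simp
    have h2 : (2 : ℝ) ^ (-(n : ℤ)) = 2 * (2 : ℝ) ^ (-(n + 1 : ℤ)) := by
      rw [← zpow_one_add₀ two_ne_zero]; congr 1; ring
    nlinarith

lemma sub_inj_n {n n' : ℕ} {m : Fin (2 ^ (n + 1))} {m' : Fin (2 ^ (n' + 1))} {ξ : ℝ}
    (h : ξ ∈ subInterval n m) (h' : ξ ∈ subInterval n' m') : n' = n := by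
  have a := sub_dyadic h
  have a' := sub_dyadic h'
  have k1 := (zpow_lt_zpow_iff_right₀ (one_lt_two (α := ℝ))).1 (a.1.trans_lt a'.2)
  have k2 := (zpow_lt_zpow_iff_right₀ (one_lt_two (α := ℝ))).1 (a'.1.trans_lt a.2)
  omega

lemma sub_inj_m {n : ℕ} {m m' : Fin (2 ^ (n + 1))} {ξ : ℝ}
    (h : ξ ∈ subInterval n m) (h' : ξ ∈ subInterval n m') : m' = m := by
  rw [mem_sub] at h h'
  have hL := LL_pos n
  unfold bb at h h'
  have k1 : ((m : ℕ) : ℝ) < ((m' : ℕ) : ℝ) + 1 := by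
    by_contra hh; push Not at hh; nlinarith
  have k2 : ((m' : ℕ) : ℝ) < ((m : ℕ) : ℝ) + 1 := by
    by_contra hh; push Not at hh; nlinarith
  have k1' : (m : ℕ) < (m' : ℕ) + 1 := by exact_mod_cast k1
  have k2' : (m' : ℕ) < (m : ℕ) + 1 := by exact_mod_cast k2
  exact Fin.ext (by omega)

def sig (c : ℕ → ℕ → ℝ) (ξ : ℝ) : ℂ := ∑' n : ℕ, ∑ m : Fin (2 ^ (n + 1)),
  ((c n m : ℝ) : ℂ) * Set.indicator (subInterval n m) (fun _ => (1 : ℂ)) ξ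

lemma sig_eq (c : ℕ → ℕ → ℝ) {n : ℕ} {m : Fin (2 ^ (n + 1))} {ξ : ℝ}
    (h : ξ ∈ subInterval n m) : sig c ξ = c n m := by
  unfold sig
  rw [tsum_eq_single n, Finset.sum_eq_single m]
  · rw [Set.indicator_of_mem h, mul_one]
  · intro m' _ hm
    rw [Set.indicator_of_notMem (fun h' => hm (sub_inj_m h h')), mul_zero]
  · simp
  · intro n' hn
    refine Finset.sum_eq_zero fun m' _ => ?_
    rw [Set.indicator_of_notMem (fun h' => hn (sub_inj_n h h')), mul_zero]

lemma sig_mul (c : ℕ → ℕ → ℝ) (n : ℕ) (e : ℕ → ℝ) (ξ : ℝ) :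
    sig c ξ * ∑ m ∈ Finset.range (2 ^ (n + 1)), (e m : ℂ) * Psi ((ξ - bb n m) / LL n) =
    ∑ m ∈ Finset.range (2 ^ (n + 1)), ((c n m * e m : ℝ) : ℂ) * Psi ((ξ - bb n m) / LL n) := by
  have hL := LL_pos n
  rw [Finset.mul_sum]
  refine Finset.sum_congr rfl fun m hm => ?_
  by_cases h : (ξ - bb n m) / LL n ∈ Set.Ico (0:ℝ) 1
  · have : ξ ∈ subInterval n ⟨m, Finset.mem_range.1 hm⟩ := by
      rw [mem_sub]
      obtain ⟨h1, h2⟩ := h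
      rw [div_lt_iff₀ hL] at h2
      rw [le_div_iff₀ hL] at h1
      constructor <;> dsimp only <;> linarith
    rw [sig_eq c this]; push_cast; ring
  · rw [Psi_zero h]; simp

lemma exists_test (c : ℕ → ℕ → ℝ) (n : ℕ) (e : ℕ → ℝ) : ∃ f : SchwartzMap ℝ ℂ,
    (∀ x, ‖f x‖ = LL n * ‖phi (LL n * x) * DD (2 ^ (n + 1)) e (LL n * x)‖) ∧
    (∀ x, ‖mulOp1 (sig c) f x‖ =
      LL n * ‖phi (LL n * x) * DD (2 ^ (n + 1)) (fun m => c n m * e m) (LL n * x)‖) := by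
  have hL := LL_pos n
  obtain ⟨H, hH⟩ := H_exists n e
  have hH' : ⇑H = fun ξ => ∑ m ∈ Finset.range (2 ^ (n + 1)),
      (e m : ℂ) * Psi ((ξ - bb n m) / LL n) := funext hH
  have nrm : ∀ (e : ℕ → ℝ) (x : ℝ), ‖(LL n : ℂ) * ez ((2 : ℝ) ^ (-(n + 1 : ℤ)) * x) *
      (phi (LL n * x) * DD (2 ^ (n + 1)) e (LL n * x))‖ =
      LL n * ‖phi (LL n * x) * DD (2 ^ (n + 1)) e (LL n * x)‖ := by
    intro e x
    rw [norm_mul, norm_mul, norm_ez, mul_one, Complex.norm_of_nonneg hL.le]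
  refine ⟨FourierTransformInv.fourierInv H, fun x => ?_, fun x => ?_⟩
  · rw [← fourierInv1_eq, hH', inv_H, nrm]
  · rw [mulOp1, fourier1_eq, FourierTransform.fourier_fourierInv_eq, hH']
    simp only [sig_mul]
    rw [inv_H n (fun m => c n m * e m), nrm]

lemma eLpNorm_scale {p : ℝ≥0∞} (hp0 : p ≠ 0) (hpt : p ≠ ⊤) (n : ℕ) (e : ℕ → ℝ) (g : ℝ → ℂ)
    (hg : ∀ x, ‖g x‖ = LL n * ‖phi (LL n * x) * DD (2 ^ (n + 1)) e (LL n * x)‖) :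
    eLpNorm g p volume = (ENNReal.ofReal (LL n ^ p.toReal * (LL n)⁻¹) *
      II p.toReal phi (2 ^ (n + 1)) e) ^ (1 / p.toReal) := by
  have hL := LL_pos n
  rw [eLpNorm_eq_lintegral_rpow_enorm_toReal hp0 hpt]
  congr 1
  set q := p.toReal with hq
  have hq0 : 0 ≤ q := ENNReal.toReal_nonneg
  set G : ℝ → ℝ≥0∞ := fun x => ENNReal.ofReal (‖phi x * DD (2 ^ (n + 1)) e x‖ ^ q) with hG
  have hGm : Measurable G := by
    have h1 := phi.continuous.measurable
    have h2 := (continuous_DD (2 ^ (n + 1)) e).measurable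
    fun_prop
  have e1 : ∀ x, ‖g x‖ₑ ^ q = ENNReal.ofReal (LL n ^ q) * G (LL n * x) := by
    intro x
    rw [← ofReal_norm, hg, ENNReal.ofReal_rpow_of_nonneg (by positivity) hq0, hG,
      ← ENNReal.ofReal_mul (by positivity), Real.mul_rpow hL.le (norm_nonneg _)]
  simp only [e1]
  rw [lintegral_const_mul' _ _ ENNReal.ofReal_ne_top]
  have e2 : ∫⁻ x, G (LL n * x) = ENNReal.ofReal (LL n)⁻¹ * ∫⁻ x, G x := by
    rw [← lintegral_map hGm (measurable_const_mul (LL n)), Real.map_volume_mul_left hL.ne',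
      lintegral_smul_measure, abs_of_pos (inv_pos.2 hL), smul_eq_mul]
  rw [e2, ← mul_assoc, ← ENNReal.ofReal_mul (by positivity)]
  rfl

lemma not_mult {p : ℝ≥0∞} (hp0 : p ≠ 0) (hpt : p ≠ ⊤) (c : ℕ → ℕ → ℝ)
    (h : ∀ C : ℝ≥0, ∃ n, ∃ e : ℕ → ℝ, C * II p.toReal phi (2 ^ (n + 1)) e <
      II p.toReal phi (2 ^ (n + 1)) (fun m => c n m * e m)) :
    ¬ IsLpMultiplier1 p (sig c) := by
  rintro ⟨C, hC⟩
  have hq : 0 < p.toReal := ENNReal.toReal_pos hp0 hpt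
  obtain ⟨n, e, hlt⟩ := h (C ^ p.toReal)
  obtain ⟨f, hf1, hf2⟩ := exists_test c n e
  have hL := LL_pos n
  have := hC f
  rw [eLpNorm_scale hp0 hpt n e f hf1, eLpNorm_scale hp0 hpt n _ _ hf2] at this
  set K := ENNReal.ofReal (LL n ^ p.toReal * (LL n)⁻¹) with hK
  have hK0 : K ≠ 0 := by
    rw [hK, ne_eq, ENNReal.ofReal_eq_zero, not_le]; positivity
  have hKt : K ≠ ⊤ := ENNReal.ofReal_ne_top
  have h2 := ENNReal.rpow_le_rpow this hq.le
  rw [ENNReal.mul_rpow_of_nonneg _ _ hq.le, ← ENNReal.rpow_mul, ← ENNReal.rpow_mul,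
    one_div_mul_cancel hq.ne', ENNReal.rpow_one, ENNReal.rpow_one, mul_left_comm,
    ENNReal.mul_le_mul_iff_right hK0 hKt, ← ENNReal.coe_rpow_of_nonneg _ hq.le] at h2
  exact absurd hlt (not_lt.2 h2)

/-- For `1 < p < ∞`, `p ≠ 2`, there is a bounded sequence `(c_{n,m})` such
that `σ = Σ_{n} Σ_m c_{n,m} χ_{ω_{n,m}}` is not a Fourier multiplier on `L^p(ℝ)`. -/
theorem exists_bounded_coeffs_not_lp_multiplier (p : ℝ≥0∞) (hp1 : 1 < p) (hp2 : p ≠ ∞)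
    (hp3 : p ≠ 2) :
    ∃ c : (n : ℕ) → Fin (2 ^ (n + 1)) → ℝ,
      (∀ n m, |c n m| ≤ 1) ∧
      ¬ IsLpMultiplier1 p
        (fun ξ => ∑' n : ℕ, ∑ m : Fin (2 ^ (n + 1)),
          (c n m : ℂ) * Set.indicator (subInterval n m) (fun _ => (1 : ℂ)) ξ) := by
  have hp0 : p ≠ 0 := (zero_lt_one.trans hp1).ne'
  suffices ∃ c : ℕ → ℕ → ℝ, (∀ n m, c n m = 1 ∨ c n m = -1) ∧
      ∀ C : ℝ≥0, ∃ n, ∃ e : ℕ → ℝ, C * II p.toReal phi (2 ^ (n + 1)) e <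
      II p.toReal phi (2 ^ (n + 1)) (fun m => c n m * e m) by
    obtain ⟨c, hc, h⟩ := this
    refine ⟨fun n m => c n m, fun n m => ?_, not_mult hp0 hp2 c h⟩
    rcases hc n m with h | h <;> simp [h]
  have hq1 : 1 < p.toReal := by
    have := (ENNReal.toReal_lt_toReal ENNReal.one_ne_top hp2).2 hp1
    simpa using this
  have hq2 : p.toReal ≠ 2 := by
    intro h
    apply hp3
    rw [← ENNReal.ofReal_toReal hp2, h]; simp
  choose a b ha hb hab using fun n : ℕ => rs (n + 1)
  rcases lt_or_gt_of_ne hq2 with hlt | hgt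
  · refine ⟨fun n => if II p.toReal phi (2 ^ (n + 1)) (b n) ≤ II p.toReal phi (2 ^ (n + 1)) (a n)
      then a n else b n, fun n m => ?_, fun C => ?_⟩
    · dsimp only; split_ifs
      exacts [ha n m, hb n m]
    · obtain ⟨n, hn⟩ := core_lt hq1 hlt phi phi_zero C
      refine ⟨n, fun _ => 1, ?_⟩
      have := hn (a n) (b n) (hab n)
      simp only [mul_one]
      split_ifs with h
      · rwa [max_eq_left h] at this
      · rwa [max_eq_right (le_of_not_ge h)] at this
  · refine ⟨a, ha, fun C => ?_⟩
    obtain ⟨n, hn⟩ := core_gt hgt phi phi_zero C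
    refine ⟨n, a n, ?_⟩
    have h1 : (fun m => a n m * a n m) = fun _ => (1:ℝ) := by
      ext m; rcases ha n m with h | h <;> simp [h]
    rw [h1]
    refine hn (a n) fun x => ?_
    have := hab n x
    nlinarith [sq_nonneg ‖DD (2 ^ (n + 1)) (b n) x‖]
end
end

section
/- If Ω = {ω_n} is a collection of intervals in ℝ such that σ_{Ω,a} = Σ_n a_n χ_{ω_n} is a Fourier multiplier on M_{p,q}(ℝ) for every bounded sequence a = (a_n) with multiplier norm ≤ C‖a‖_∞, then the Littlewood–Paley square function is bounded: ‖(Σ_n |S_{ω_n} f|²)^{1/2}‖_{M_{p,q}} ≤ C_{p,q} ‖f‖_{M_{p,q}} for all f ∈ 𝒮(ℝ), where the left side denotes the M_{p,q}(ℓ²) norm of (S_{ω_n} f). -/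
open MeasureTheory Complex
open scoped ENNReal NNReal Real

noncomputable section

def sgn' (T : Finset ℤ) (n : ℤ) : ℝ := if n ∈ T then 1 else -1

lemma kh_step (S : Finset ℤ) (n : ℤ) (hn : n ∉ S) (a : ℤ → ℝ) (φ : ℝ → ℝ) :
    ∑ T ∈ (insert n S).powerset, φ (∑ m ∈ insert n S, sgn' T m * a m)
     = ∑ T ∈ S.powerset, (φ ((∑ m ∈ S, sgn' T m * a m) - a n) + φ ((∑ m ∈ S, sgn' T m * a m) + a n)) := by
  rw [Finset.sum_powerset_insert hn, ← Finset.sum_add_distrib]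
  refine Finset.sum_congr rfl fun T hT => ?_
  have hnT : n ∉ T := fun h => hn (Finset.mem_powerset.1 hT h)
  have h2 : ∑ m ∈ S, sgn' (insert n T) m * a m = ∑ m ∈ S, sgn' T m * a m := by
    refine Finset.sum_congr rfl fun m hm => ?_
    have : m ≠ n := fun h => hn (h ▸ hm)
    simp [sgn', this]
  rw [Finset.sum_insert hn, Finset.sum_insert hn, h2]
  congr 2
  · simp [sgn', hnT]; ring
  · simp [sgn']; ring

lemma kh2 (S : Finset ℤ) (a : ℤ → ℝ) :
    ∑ T ∈ S.powerset, (∑ m ∈ S, sgn' T m * a m) ^ 2 = 2 ^ S.card * ∑ m ∈ S, a m ^ 2 := by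
  induction S using Finset.induction_on with
  | empty => simp
  | insert n S hn ih =>
    rw [kh_step S n hn a (fun x => x ^ 2), Finset.card_insert_of_notMem hn, Finset.sum_insert hn]
    have : ∀ x : ℝ, (x - a n) ^ 2 + (x + a n) ^ 2 = 2 * x ^ 2 + 2 * a n ^ 2 := fun x => by ring
    simp only [this, Finset.sum_add_distrib, ← Finset.mul_sum, ih]
    simp; ring

lemma kh4 (S : Finset ℤ) (a : ℤ → ℝ) :
    ∑ T ∈ S.powerset, (∑ m ∈ S, sgn' T m * a m) ^ 4 ≤ 2 ^ S.card * (3 * (∑ m ∈ S, a m ^ 2) ^ 2) := by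
  induction S using Finset.induction_on with
  | empty => simp
  | insert n S hn ih =>
    rw [kh_step S n hn a (fun x => x ^ 4), Finset.card_insert_of_notMem hn, Finset.sum_insert hn]
    have : ∀ x : ℝ, (x - a n) ^ 4 + (x + a n) ^ 4 = 2 * x ^ 4 + (12 * a n ^ 2) * x ^ 2 + 2 * a n ^ 4 := fun x => by ring
    simp only [this, Finset.sum_add_distrib, ← Finset.mul_sum, kh2]
    simp
    have h0 : (0:ℝ) ≤ 2 ^ S.card * a n ^ 4 := by positivity
    rw [pow_succ (2:ℝ)]
    nlinarith

lemma kh1 (S : Finset ℤ) (a : ℤ → ℝ) :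
    2 ^ S.card * √(∑ m ∈ S, a m ^ 2) ≤ 2 * ∑ T ∈ S.powerset, |∑ m ∈ S, sgn' T m * a m| := by
  set s := √(∑ m ∈ S, a m ^ 2) with hs
  have hs0 : 0 ≤ s := Real.sqrt_nonneg _
  have hss : s ^ 2 = ∑ m ∈ S, a m ^ 2 := Real.sq_sqrt (by positivity)
  rcases hs0.eq_or_lt with h | h
  · rw [← h]; simp; positivity
  have key : ∀ x : ℝ, x ^ 2 * s ^ 2 - (4 / 27) * x ^ 4 ≤ |x| * s ^ 3 := by
    intro x
    rw [← sq_abs x, show x ^ 4 = |x| ^ 4 by rw [← abs_pow, abs_of_nonneg]; positivity]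
    have hx := abs_nonneg x
    have : 0 ≤ |x| * ((3 * s - 2 * |x|) ^ 2 * (|x| + 3 * s)) := by positivity
    nlinarith
  have := Finset.sum_le_sum fun T (_ : T ∈ S.powerset) => key (∑ m ∈ S, sgn' T m * a m)
  rw [Finset.sum_sub_distrib, ← Finset.sum_mul, ← Finset.mul_sum, ← Finset.sum_mul, kh2, ← hss] at this
  have h4 := kh4 S a
  rw [← hss] at h4
  have hp : 0 < s ^ 3 := by positivity
  refine le_of_mul_le_mul_right ?_ hp
  have h0 : (0:ℝ) ≤ 2 ^ S.card * s ^ 4 := by positivity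
  nlinarith

lemma khC (S : Finset ℤ) (a : ℤ → ℂ) :
    √(∑ m ∈ S, ‖a m‖ ^ 2) ≤ (4 / 2 ^ S.card) * ∑ T ∈ S.powerset, ‖∑ m ∈ S, (sgn' T m : ℂ) * a m‖ := by
  have hre := kh1 S (fun m => (a m).re)
  have him := kh1 S (fun m => (a m).im)
  have h1 : √(∑ m ∈ S, ‖a m‖ ^ 2) ≤ √(∑ m ∈ S, (a m).re ^ 2) + √(∑ m ∈ S, (a m).im ^ 2) := by
    rw [Real.sqrt_le_left (by positivity), add_sq, Real.sq_sqrt (by positivity), Real.sq_sqrt (by positivity)]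
    have : ∑ m ∈ S, ‖a m‖ ^ 2 = ∑ m ∈ S, (a m).re ^ 2 + ∑ m ∈ S, (a m).im ^ 2 := by
      rw [← Finset.sum_add_distrib]
      refine Finset.sum_congr rfl fun m _ => ?_
      rw [Complex.sq_norm, Complex.normSq_apply]; ring
    rw [this]
    have : 0 ≤ 2 * √(∑ m ∈ S, (a m).re ^ 2) * √(∑ m ∈ S, (a m).im ^ 2) := by positivity
    linarith
  have h2 : ∑ T ∈ S.powerset, |∑ m ∈ S, sgn' T m * (a m).re| ≤ ∑ T ∈ S.powerset, ‖∑ m ∈ S, (sgn' T m : ℂ) * a m‖ := by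
    refine Finset.sum_le_sum fun T _ => ?_
    refine le_trans (le_of_eq ?_) (Complex.abs_re_le_norm _)
    simp
  have h3 : ∑ T ∈ S.powerset, |∑ m ∈ S, sgn' T m * (a m).im| ≤ ∑ T ∈ S.powerset, ‖∑ m ∈ S, (sgn' T m : ℂ) * a m‖ := by
    refine Finset.sum_le_sum fun T _ => ?_
    refine le_trans (le_of_eq ?_) (Complex.abs_im_le_norm _)
    simp
  rw [div_mul_eq_mul_div, le_div_iff₀ (by positivity)]
  have : √(∑ m ∈ S, ‖a m‖ ^ 2) * 2 ^ S.card ≤ (√(∑ m ∈ S, (a m).re ^ 2) + √(∑ m ∈ S, (a m).im ^ 2)) * 2 ^ S.card := by gcongr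
  linarith

lemma meas_inner {E : Type*} [NormedAddCommGroup E] (p : ℝ≥0∞) (H : ℝ → ℝ → E)
    (hx : ∀ ξ, AEStronglyMeasurable (fun x => H x ξ) volume) (hξ : ∀ x, Continuous (H x)) :
    Measurable (fun ξ => eLpNorm (fun x => H x ξ) p volume) := by
  refine LowerSemicontinuous.measurable ?_
  rw [lowerSemicontinuous_iff_isClosed_preimage]
  intro y
  refine IsSeqClosed.isClosed ?_
  intro u ξ hu hlim
  have := Lp.eLpNorm_lim_le_liminf_eLpNorm (p := p) (μ := volume) (f := fun n x => H x (u n))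
    (fun n => hx (u n)) (fun x => H x ξ)
    (Filter.Eventually.of_forall fun x => ((hξ x).tendsto ξ).comp hlim)
  refine this.trans ?_
  refine (Filter.liminf_le_liminf (v := fun _ => y) (Filter.Eventually.of_forall hu)).trans ?_
  simp

lemma avg_bound (p : ℝ≥0∞) (hp : 1 ≤ p) (S : Finset ℤ) (B : Finset ℤ → ℝ → ℝ)
    (hB : ∀ T, AEStronglyMeasurable (B T) volume) :
    eLpNorm (fun x => (4 / 2 ^ S.card) * ∑ T ∈ S.powerset, B T x) p volume
      ≤ ENNReal.ofReal (4 / 2 ^ S.card) * ∑ T ∈ S.powerset, eLpNorm (B T) p volume := by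
  have h1 : (fun x => (4 / 2 ^ S.card) * ∑ T ∈ S.powerset, B T x)
      = ((4 / 2 ^ S.card : ℝ)) • (∑ T ∈ S.powerset, B T) := by
    ext x; simp
  rw [h1, eLpNorm_const_smul, Real.enorm_eq_ofReal (by positivity)]
  gcongr
  exact eLpNorm_sum_le (fun i _ => hB i) hp

lemma abstract_lp (p q : ℝ≥0∞) (hp : 1 ≤ p) (hq : 1 ≤ q) (F : ℤ → ℝ → ℝ → ℂ)
    (u : ℤ → ℝ) (hu : Summable u) (hF : ∀ n x ξ, ‖F n x ξ‖ ≤ u n)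
    (hx : ∀ n ξ, AEStronglyMeasurable (fun x => F n x ξ) volume)
    (hξ : ∀ n x, Continuous (F n x)) (D : ℝ≥0∞)
    (hD : ∀ S T : Finset ℤ, eLpNorm (fun ξ : ℝ =>
      (eLpNorm (fun x : ℝ => ∑ n ∈ S, (sgn' T n : ℂ) * F n x ξ) p volume).toReal) q volume ≤ D) :
    eLpNorm (fun ξ : ℝ =>
    (eLpNorm (fun x : ℝ => Real.sqrt (∑' m : ℤ, ‖F m x ξ‖ ^ 2)) p volume).toReal)
    q volume ≤ 4 * D := by
  have hu0 : ∀ n, 0 ≤ u n := fun n => (norm_nonneg _).trans (hF n 0 0)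
  have hu2 : Summable (fun n => u n ^ 2) := by
    have := (hu.mul_of_nonneg hu hu0 hu0).comp_injective (i := fun n : ℤ => (n, n)) (fun a b h => by simpa using h)
    simp only [pow_two]
    exact this
  have hF2 : ∀ n x ξ, ‖F n x ξ‖ ^ 2 ≤ u n ^ 2 := fun n x ξ => by gcongr; exact hF n x ξ
  have hsum : ∀ x ξ, Summable (fun n => ‖F n x ξ‖ ^ 2) := fun x ξ =>
    Summable.of_nonneg_of_le (fun n => by positivity) (fun n => hF2 n x ξ) hu2
  set S : ℕ → Finset ℤ := fun N => Finset.Icc (-(N : ℤ)) N with hS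
  have hSt : Filter.Tendsto S Filter.atTop Filter.atTop := by
    refine Filter.tendsto_atTop_finset_of_monotone ?_ ?_
    · intro a b h
      exact Finset.Icc_subset_Icc (by simpa using h) (by simpa using h)
    · intro n
      refine ⟨n.natAbs, ?_⟩
      simp only [hS, Finset.mem_Icc]; omega
  -- square functions
  set Q : ℝ → ℝ → ℝ := fun x ξ => √(∑' m : ℤ, ‖F m x ξ‖ ^ 2) with hQ
  set QN : ℕ → ℝ → ℝ → ℝ := fun N x ξ => √(∑ m ∈ S N, ‖F m x ξ‖ ^ 2) with hQN
  have hQlim : ∀ x ξ, Filter.Tendsto (fun N => QN N x ξ) Filter.atTop (nhds (Q x ξ)) := fun x ξ =>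
    (Real.continuous_sqrt.tendsto _).comp ((hsum x ξ).hasSum.comp hSt)
  have hQNle : ∀ N x ξ, QN N x ξ ≤ Q x ξ := fun N x ξ =>
    Real.sqrt_le_sqrt ((hsum x ξ).sum_le_tsum _ (fun _ _ => by positivity))
  have hFQ : ∀ n x ξ, ‖F n x ξ‖ ≤ Q x ξ := fun n x ξ =>
    Real.le_sqrt_of_sq_le ((hsum x ξ).le_tsum n (fun _ _ => by positivity))
  have hQNx : ∀ N ξ, AEStronglyMeasurable (fun x => QN N x ξ) volume := by
    intro N ξ
    refine Real.continuous_sqrt.comp_aestronglyMeasurable ?_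
    exact Finset.aestronglyMeasurable_fun_sum _ (fun m _ => ((hx m ξ).norm.pow 2))
  have hQNξ : ∀ N x, Continuous (QN N x) := by
    intro N x
    refine Real.continuous_sqrt.comp ?_
    exact continuous_finsetSum _ (fun m _ => ((hξ m x).norm.pow 2))
  have hQx : ∀ ξ, AEStronglyMeasurable (fun x => Q x ξ) volume := fun ξ =>
    aestronglyMeasurable_of_tendsto_ae Filter.atTop (fun N => hQNx N ξ)
      (Filter.Eventually.of_forall fun x => hQlim x ξ)
  have hQξ : ∀ x, Continuous (Q x) := by
    intro x
    refine Real.continuous_sqrt.comp ?_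
    refine continuous_tsum (fun n => ((hξ n x).norm.pow 2)) hu2 (fun n ξ => ?_)
    simpa using hF2 n x ξ
  set I : ℝ → ℝ≥0∞ := fun ξ => eLpNorm (fun x => Q x ξ) p volume with hI
  set IN : ℕ → ℝ → ℝ≥0∞ := fun N ξ => eLpNorm (fun x => QN N x ξ) p volume with hIN
  have hIm : Measurable I := meas_inner p Q hQx hQξ
  have hINm : ∀ N, Measurable (IN N) := fun N => meas_inner p (QN N) (hQNx N) (hQNξ N)
  have hINI : ∀ N ξ, IN N ξ ≤ I ξ := fun N ξ => eLpNorm_mono_real fun x => by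
    rw [Real.norm_of_nonneg (Real.sqrt_nonneg _)]; exact hQNle N x ξ
  have hIlim : ∀ ξ, Filter.Tendsto (fun N => IN N ξ) Filter.atTop (nhds (I ξ)) := by
    intro ξ
    refine tendsto_of_le_liminf_of_limsup_le ?_ ?_
    · exact Lp.eLpNorm_lim_le_liminf_eLpNorm (fun N => hQNx N ξ) _ 
        (Filter.Eventually.of_forall fun x => hQlim x ξ)
    · refine (Filter.limsup_le_limsup (v := fun _ => I ξ) (Filter.Eventually.of_forall fun N => hINI N ξ)).trans ?_
      simp
  set G : Set ℝ := {ξ | I ξ < ∞} with hG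
  have hGm : MeasurableSet G := measurableSet_lt hIm measurable_const
  set H : Finset ℤ → Finset ℤ → ℝ → ℝ → ℂ := fun S T x ξ => ∑ n ∈ S, (sgn' T n : ℂ) * F n x ξ with hH
  have hHx : ∀ S T ξ, AEStronglyMeasurable (fun x => H S T x ξ) volume := fun S T ξ =>
    Finset.aestronglyMeasurable_fun_sum _ (fun m _ => ((hx m ξ).const_mul _))
  have hHξ : ∀ S T x, Continuous (H S T x) := fun S T x =>
    continuous_finsetSum _ (fun m _ => (continuous_const.mul (hξ m x)))
  have hHm : ∀ S T, Measurable (fun ξ => (eLpNorm (fun x => H S T x ξ) p volume).toReal) := fun S T =>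
    (meas_inner p (H S T) (hHx S T) (hHξ S T)).ennreal_toReal
  have hHfin : ∀ S T, ∀ ξ ∈ G, eLpNorm (fun x => H S T x ξ) p volume ≠ ∞ := by
    intro S T ξ hξG
    have : MemLp (fun x => Q x ξ) p volume := ⟨hQx ξ, hξG⟩
    have hmem : MemLp (fun x => H S T x ξ) p volume := by
      refine memLp_finsetSum _ fun n _ => ?_
      refine MemLp.const_mul ?_ _
      exact this.of_le (hx n ξ) (Filter.Eventually.of_forall fun x => by
        rw [Real.norm_of_nonneg (Real.sqrt_nonneg _)]; exact hFQ n x ξ)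
    exact hmem.2.ne
  have hpt : ∀ N, ∀ ξ, ‖G.indicator (fun ξ => (IN N ξ).toReal) ξ‖ ≤
      (4 / 2 ^ (S N).card) * ∑ T ∈ (S N).powerset, (eLpNorm (fun x => H (S N) T x ξ) p volume).toReal := by
    intro N ξ
    by_cases hξG : ξ ∈ G
    swap
    · rw [Set.indicator_of_notMem hξG, norm_zero]; positivity
    rw [Set.indicator_of_mem hξG, Real.norm_of_nonneg ENNReal.toReal_nonneg]
    have h1 : IN N ξ ≤ ENNReal.ofReal (4 / 2 ^ (S N).card) * ∑ T ∈ (S N).powerset, eLpNorm (fun x => ‖H (S N) T x ξ‖) p volume := by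
      refine le_trans ?_ (avg_bound p hp (S N) (fun T x => ‖H (S N) T x ξ‖) (fun T => (hHx (S N) T ξ).norm))
      refine eLpNorm_mono_real fun x => ?_
      rw [Real.norm_of_nonneg (Real.sqrt_nonneg _)]
      exact khC (S N) (fun n => F n x ξ)
    simp only [eLpNorm_norm] at h1
    have h2 := ENNReal.toReal_mono (ENNReal.mul_ne_top ENNReal.ofReal_ne_top (ENNReal.sum_ne_top.2 fun T _ => hHfin (S N) T ξ hξG)) h1
    rw [ENNReal.toReal_mul, ENNReal.toReal_ofReal (by positivity), ENNReal.toReal_sum fun T _ => hHfin (S N) T ξ hξG] at h2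
    exact h2
  have hN : ∀ N, eLpNorm (G.indicator (fun ξ => (IN N ξ).toReal)) q volume ≤ 4 * D := by
    intro N
    refine (eLpNorm_mono_real (hpt N)).trans ?_
    refine (avg_bound q hq (S N) (fun T ξ => (eLpNorm (fun x => H (S N) T x ξ) p volume).toReal) (fun T => (hHm (S N) T).aestronglyMeasurable)).trans ?_
    calc _ ≤ ENNReal.ofReal (4 / 2 ^ (S N).card) * ∑ T ∈ (S N).powerset, D := by
            gcongr with T _
            exact hD (S N) T
      _ = 4 * D := by
        rw [Finset.sum_const, Finset.card_powerset, nsmul_eq_mul, ← mul_assoc]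
        congr 1
        rw [← ENNReal.ofReal_natCast, ← ENNReal.ofReal_mul (by positivity)]
        push_cast
        rw [div_mul_cancel₀ _ (by positivity)]
        simp
  refine (Lp.eLpNorm_lim_le_liminf_eLpNorm (f := fun N => G.indicator (fun ξ => (IN N ξ).toReal))
    (fun N => ((hINm N).ennreal_toReal.indicator hGm).aestronglyMeasurable) _
    (Filter.Eventually.of_forall fun ξ => ?_)).trans ?_
  · by_cases hξG : ξ ∈ G
    · simp only [Set.indicator_of_mem hξG]
      exact (ENNReal.tendsto_toReal hξG.ne).comp (hIlim ξ)
    · simp only [Set.indicator_of_notMem hξG]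
      have : I ξ = ∞ := by simpa [hG] using hξG
      change Filter.Tendsto _ _ (nhds (I ξ).toReal)
      rw [this]; simp
  · refine (Filter.liminf_le_liminf (v := fun _ => 4 * D) (Filter.Eventually.of_forall hN)).trans ?_
    simp

lemma fourier1_integrable (f : SchwartzMap ℝ ℂ) : Integrable (fourier1 ⇑f) volume := by
  have : fourier1 ⇑f = ⇑(FourierTransform.fourier f) := by
    rw [SchwartzMap.fourier_coe]
    ext ξ
    rw [Real.fourier_real_eq_integral_exp_smul]
    simp only [fourier1, smul_eq_mul, mul_assoc]
  rw [this]
  exact SchwartzMap.integrable _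

lemma norm_e (r : ℝ) : ‖Complex.exp (Complex.ofReal r * Complex.I)‖ = 1 :=
  Complex.norm_exp_ofReal_mul_I r

lemma cont_e (f : ℝ → ℝ) (hf : Continuous f) :
    Continuous fun t => Complex.exp (Complex.ofReal (f t) * Complex.I) := by fun_prop

lemma inv_integrand (h : ℝ → ℂ) (hh : Integrable h volume) (x : ℝ) : Integrable
    (fun ξ => Complex.exp (Complex.ofReal (2 * Real.pi * (x * ξ)) * Complex.I) * h ξ) volume := by
  refine hh.bdd_mul (c := 1) (by fun_prop) (Filter.Eventually.of_forall fun ξ => (norm_e _).le)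

lemma fourierInv1_cont (h : ℝ → ℂ) (hh : Integrable h volume) : Continuous (fourierInv1 h) := by
  refine continuous_of_dominated (bound := fun ξ => ‖h ξ‖) (fun x => (inv_integrand h hh x).1) (fun x => Filter.Eventually.of_forall fun ξ => ?_) hh.norm
    (Filter.Eventually.of_forall fun ξ => ?_)
  · rw [norm_mul, norm_e, one_mul]
  · fun_prop

lemma fourierInv1_le (h : ℝ → ℂ) (x : ℝ) : ‖fourierInv1 h x‖ ≤ ∫ ξ, ‖h ξ‖ := by
  refine (norm_integral_le_integral_norm _).trans (le_of_eq ?_)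
  congr 1; ext ξ; rw [norm_mul, norm_e, one_mul]

lemma g_shift (g : SchwartzMap ℝ ℂ) (x : ℝ) : Integrable (fun t => g (t - x)) volume :=
  g.integrable.comp_sub_right x

lemma stft_integrand (g : SchwartzMap ℝ ℂ) (h : ℝ → ℂ) (hc : Continuous h) (M : ℝ) (hM : ∀ t, ‖h t‖ ≤ M) (x ξ : ℝ) :
    Integrable (fun t => Complex.exp (Complex.ofReal (-2 * Real.pi * (t * ξ)) * Complex.I) *
    (starRingEnd ℂ) (g (t - x)) * h t) volume := by
  have gc := g.continuous
  refine Integrable.mono' ((g_shift g x).norm.mul_const M) (Continuous.aestronglyMeasurable (by fun_prop)) (Filter.Eventually.of_forall fun t => ?_)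
  rw [norm_mul, norm_mul, norm_e, one_mul, RCLike.norm_conj]
  gcongr; exact hM t

lemma stft_cont (g : SchwartzMap ℝ ℂ) (h : ℝ → ℂ) (hc : Continuous h) (M : ℝ) (hM : ∀ t, ‖h t‖ ≤ M) (x : ℝ) :
    Continuous (STFT1 g h x) := by
  refine continuous_of_dominated (bound := fun t => ‖g (t - x)‖ * M) (fun ξ => (stft_integrand g h hc M hM x ξ).1) (fun ξ => Filter.Eventually.of_forall fun t => ?_) ((g_shift g x).norm.mul_const M)
    (Filter.Eventually.of_forall fun ξ => ?_)
  · rw [norm_mul, norm_mul, norm_e, one_mul, RCLike.norm_conj]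
    gcongr; exact hM t
  · fun_prop

lemma stft_meas (g : SchwartzMap ℝ ℂ) (h : ℝ → ℂ) (hc : Continuous h) (ξ : ℝ) :
    AEStronglyMeasurable (fun x => STFT1 g h x ξ) volume := by
  have gc := g.continuous
  refine StronglyMeasurable.aestronglyMeasurable ?_
  refine StronglyMeasurable.integral_prod_right (ν := volume) (f := fun x t => Complex.exp (Complex.ofReal (-2 * Real.pi * (t * ξ)) * Complex.I) *
    (starRingEnd ℂ) (g (t - x)) * h t) ?_
  refine Continuous.stronglyMeasurable ?_
  simp only [Function.uncurry_def]
  fun_prop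

lemma stft_le (g : SchwartzMap ℝ ℂ) (h : ℝ → ℂ) (M : ℝ) (hM : ∀ t, ‖h t‖ ≤ M) (x ξ : ℝ) :
    ‖STFT1 g h x ξ‖ ≤ (∫ t, ‖g t‖) * M := by
  have h1 : ∫ t, ‖g t‖ = ∫ t, ‖g (t - x)‖ := (integral_sub_right_eq_self (fun t => ‖g t‖) x).symm
  rw [h1, ← integral_mul_const]
  refine norm_integral_le_of_norm_le ((g_shift g x).norm.mul_const M) (Filter.Eventually.of_forall fun t => ?_)
  rw [norm_mul, norm_mul, norm_e, one_mul, RCLike.norm_conj]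
  gcongr; exact hM t

/-- If `σ_{Ω,a} = Σ_n a_n χ_{ω_n}` is a Fourier multiplier on `M_{p,q}(ℝ)`
for every bounded sequence `a` with norm at most `C ‖a‖_∞`, then the Littlewood–Paley
square function associated to `Ω` is bounded on `M_{p,q}(ℝ)`. -/
theorem littlewood_paley_of_multipliers (p q : ℝ≥0∞) (hp : 1 ≤ p) (hq : 1 ≤ q)
    (g : SchwartzMap ℝ ℂ) (hg : (⇑g : ℝ → ℂ) ≠ 0)
    (a b : ℤ → ℝ)
    (hdisj : ∀ m n : ℤ, m ≠ n → Disjoint (Set.Ico (a m) (b m)) (Set.Ico (a n) (b n)))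
    (C : ℝ≥0)
    (hmult : ∀ (c : ℤ → ℝ) (A : ℝ≥0), (∀ n, |c n| ≤ A) →
      ∀ f : SchwartzMap ℝ ℂ,
        MNorm1 p q ⇑g
          (mulOp1
            (fun ξ => ∑' n : ℤ,
              (c n : ℂ) * Set.indicator (Set.Ico (a n) (b n)) (fun _ => (1 : ℂ)) ξ) ⇑f)
          ≤ (C * A : ℝ≥0) * MNorm1 p q ⇑g ⇑f) :
    ∃ C' : ℝ≥0, ∀ f : SchwartzMap ℝ ℂ,
      Ml2Norm1 p q ⇑g (fun n => cutoff (a n) (b n) ⇑f) ≤ C' * MNorm1 p q ⇑g ⇑f := by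
  refine ⟨4 * C, fun f => ?_⟩
  have hfi := fourier1_integrable f
  set χ : ℤ → ℝ → ℂ := fun n => Set.indicator (Set.Ico (a n) (b n)) (fun _ => (1 : ℂ)) with hχ
  have hprod : ∀ n, (fun ξ => χ n ξ * fourier1 f ξ) = Set.indicator (Set.Ico (a n) (b n)) (fourier1 f) := by
    intro n; ext ξ
    by_cases h : ξ ∈ Set.Ico (a n) (b n)
    · simp only [hχ, Set.indicator_of_mem h, one_mul]
    · simp only [hχ, Set.indicator_of_notMem h, zero_mul]
  have hint : ∀ n, Integrable (fun ξ => χ n ξ * fourier1 f ξ) volume := by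
    intro n; rw [hprod]; exact hfi.indicator measurableSet_Ico
  set M : ℤ → ℝ := fun n => ∫ ξ in Set.Ico (a n) (b n), ‖fourier1 f ξ‖ with hM
  have hMsum : Summable M :=
    (hasSum_integral_iUnion (f := fun ξ => ‖fourier1 f ξ‖) (μ := volume)
      (fun n => measurableSet_Ico (a := a n) (b := b n)) (fun m n h => hdisj m n h) hfi.norm.integrableOn).summable
  have hcc : ∀ n, Continuous (cutoff (a n) (b n) f) := fun n => fourierInv1_cont _ (hint n)
  have hcM : ∀ n t, ‖cutoff (a n) (b n) f t‖ ≤ M n := by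
    intro n t
    refine (fourierInv1_le _ t).trans (le_of_eq ?_)
    change _ = ∫ ξ in Set.Ico (a n) (b n), ‖fourier1 f ξ‖
    rw [← integral_indicator measurableSet_Ico]
    congr 1; ext ξ
    have := congrFun (hprod n) ξ
    rw [← norm_indicator_eq_indicator_norm, ← this]
  have key := abstract_lp p q hp hq (fun n => STFT1 g (cutoff (a n) (b n) f))
    (fun n => (∫ t, ‖g t‖) * M n) (hMsum.mul_left _)
    (fun n x ξ => stft_le g _ (M n) (hcM n) x ξ) (fun n ξ => stft_meas g _ (hcc n) ξ)
    (fun n x => stft_cont g _ (hcc n) (M n) (hcM n) x) (C * MNorm1 p q g f) ?_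
  · refine key.trans (le_of_eq ?_)
    push_cast; rw [mul_assoc]
  intro S T
  have h1 := hmult (fun n => if n ∈ S then sgn' T n else 0) 1 (fun n => by
    unfold sgn'; split_ifs <;> simp) f
  rw [mul_one] at h1
  refine le_trans (le_of_eq ?_) h1
  have hop : mulOp1 (fun ξ => ∑' n : ℤ, ((if n ∈ S then sgn' T n else 0 : ℝ) : ℂ) * χ n ξ) f
      = fun t => ∑ n ∈ S, (sgn' T n : ℂ) * cutoff (a n) (b n) f t := by
    ext t
    have hs : ∀ ξ, ∑' n : ℤ, ((if n ∈ S then sgn' T n else 0 : ℝ) : ℂ) * χ n ξ = ∑ n ∈ S, (sgn' T n : ℂ) * χ n ξ := by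
      intro ξ
      rw [tsum_eq_sum (s := S) (fun n hn => by simp [hn])]
      exact Finset.sum_congr rfl fun n hn => by simp [hn]
    simp only [mulOp1, hs, cutoff, fourierInv1, ← integral_const_mul]
    rw [← integral_finsetSum _ (fun n _ => (inv_integrand _ (hint n) t).const_mul _)]
    congr 1; ext ξ
    rw [Finset.sum_mul, Finset.mul_sum]
    exact Finset.sum_congr rfl fun n _ => by ring
  have hst : ∀ x ξ, ∑ n ∈ S, (sgn' T n : ℂ) * STFT1 g (cutoff (a n) (b n) f) x ξ
      = STFT1 g (mulOp1 (fun ξ => ∑' n : ℤ, ((if n ∈ S then sgn' T n else 0 : ℝ) : ℂ) * χ n ξ) f) x ξ := by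
    intro x ξ
    rw [hop]
    simp only [STFT1, ← integral_const_mul]
    rw [← integral_finsetSum _ (fun n _ => (stft_integrand g _ (hcc n) (M n) (hcM n) x ξ).const_mul _)]
    congr 1; ext t
    rw [Finset.mul_sum]
    exact Finset.sum_congr rfl fun n _ => by ring
  simp only [hst]
  rfl
end
end
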